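/- The invariant F_N is unchanged under the special Kirby (−)-move on the linking matrix: for every m×m symmetric integer matrix A, F_N(A ⊕ (−1)) = F_N(A), where A ⊕ (−1) is the (m+1)×(m+1) block-diagonal matrix with blocks A and the 1×1 matrix (−1). -/

import Mathlib

open Finset

noncomputable section

/-- `q = exp(2πi/N)`. -/
def qRoot (N : ℕ) : ℂ := Complex.exp (2 * Real.pi * Complex.I / N)

/-- The Gauss sum `G_k = Σ_{ν=0}^{N-1} q^{kν²}`. -/
def gauss (N : ℕ) (k : ℤ) : ℂ := ∑ ν ∈ range N, qRoot N ^ (k * (ν : ℤ) ^ 2)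

open scoped Classical in
/-- `σ(A)`: the number of nonpositive eigenvalues (with multiplicity) of the
symmetric integer matrix `A`, regarded as a real symmetric matrix. -/
def sigmaCount {n : Type*} [Fintype n] [DecidableEq n] (A : Matrix n n ℤ) : ℕ :=
  if h : (A.map (fun x : ℤ => (x : ℝ))).IsHermitian then
    (Finset.univ.filter fun i => h.eigenvalues i ≤ 0).card
  else 0

/-- The three-manifold invariant arising from `U_q(gl(2|1))` at `q = exp(2πi/N)`,
`N = 2r+1`, in the special case where only one-dimensional representations
contribute, as a function of the linking matrix `A` (of size `m = card n`):
`F_N(A) = N^{-m/2}·(G_{N-1}/√N)^{m-2σ(A)}·Σ_{x∈{0,…,N-1}^m} q^{xᵀAx}`. -/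
def FN (r : ℕ) {n : Type*} [Fintype n] [DecidableEq n] (A : Matrix n n ℤ) : ℂ :=
  ((Real.sqrt (2 * r + 1) : ℂ)) ^ (-(Fintype.card n : ℤ)) *
    (gauss (2 * r + 1) ((2 * r + 1 : ℤ) - 1) / (Real.sqrt (2 * r + 1) : ℂ)) ^
      ((Fintype.card n : ℤ) - 2 * (sigmaCount A : ℤ)) *
    ∑ x ∈ Fintype.piFinset (fun _ : n => Finset.range (2 * r + 1)),
      qRoot (2 * r + 1) ^ (∑ i, ∑ j, (x i : ℤ) * A i j * (x j : ℤ))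

theorem qRoot_zpow {N : ℕ} [NeZero N] (k : ℤ) : qRoot N ^ k = ZMod.stdAddChar (k : ZMod N) := by
  rw [ZMod.stdAddChar_coe, qRoot, ← Complex.exp_int_mul]
  congr 1
  ring

theorem sum_range_eq_sum_zmod {M : Type*} [AddCommMonoid M] {N : ℕ} [NeZero N] (f : ZMod N → M) :
    ∑ ν ∈ range N, f (ν : ZMod N) = ∑ x, f x := by
  refine Finset.sum_nbij' (fun ν => (ν : ZMod N)) ZMod.val (by simp)
    (fun x _ => mem_range.mpr x.val_lt) (fun ν h => ?_) (by simp) (by simp)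
  exact ZMod.val_cast_of_lt (mem_range.mp h)

theorem gauss_eq_sum_zmod {N : ℕ} [NeZero N] (k : ℤ) :
    gauss N k = ∑ x : ZMod N, ZMod.stdAddChar ((k : ZMod N) * x ^ 2) := by
  rw [← sum_range_eq_sum_zmod, gauss]
  refine Finset.sum_congr rfl fun ν _ => ?_
  rw [qRoot_zpow]
  push_cast
  rfl

/-- The quadratic Gauss sums of odd modulus satisfy `G₁ * G₋₁ = N`. -/
theorem gauss_one_mul_gauss_neg_one {N : ℕ} [NeZero N] (hN : Odd N) :
    gauss N 1 * gauss N (-1) = N := by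
  have h2 : IsUnit (2 : ZMod N) := by
    have h : IsUnit ((2 : ℕ) : ZMod N) :=
      (ZMod.isUnit_iff_coprime 2 N).mpr (Nat.coprime_two_left.mpr hN)
    exact_mod_cast h
  calc gauss N 1 * gauss N (-1)
      = ∑ y : ZMod N, ∑ d : ZMod N,
          ZMod.stdAddChar (d ^ 2) * ZMod.stdAddChar (y * (2 * d)) := by
        rw [gauss_eq_sum_zmod, gauss_eq_sum_zmod, Finset.sum_mul_sum, Finset.sum_comm]
        refine Finset.sum_congr rfl fun y _ => ?_
        rw [← Equiv.sum_comp (Equiv.addRight y)]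
        refine Finset.sum_congr rfl fun d _ => ?_
        rw [← AddChar.map_add_eq_mul, ← AddChar.map_add_eq_mul]
        congr 1
        simp only [Equiv.coe_addRight]
        push_cast
        ring
    _ = ∑ d : ZMod N, if d = 0 then (N : ℂ) else 0 := by
        rw [Finset.sum_comm]
        refine Finset.sum_congr rfl fun d _ => ?_
        rw [← Finset.mul_sum, AddChar.sum_mulShift _ (ZMod.isPrimitive_stdAddChar N)]
        by_cases hd : d = 0
        · simp [hd]
        · simp [hd, h2.mul_right_eq_zero]
    _ = N := by simp

theorem gauss_sub_one {N : ℕ} [NeZero N] : gauss N ((N : ℤ) - 1) = gauss N (-1) := by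
  simp [gauss_eq_sum_zmod]

theorem gauss_neg_one_ne_zero {N : ℕ} [NeZero N] (hN : Odd N) : gauss N (-1) ≠ 0 := by
  refine right_ne_zero_of_mul (a := gauss N 1) ?_
  rw [gauss_one_mul_gauss_neg_one hN]
  exact Nat.cast_ne_zero.mpr (NeZero.ne N)

theorem isHermitian_map_intCast {n : Type*} {A : Matrix n n ℤ} (hA : A.IsSymm) :
    (A.map (fun x : ℤ => (x : ℝ))).IsHermitian := by
  ext i j
  simp [hA.apply i j]

open scoped Classical in
theorem sigmaCount_eq_countP_roots {n : Type*} [Fintype n] [DecidableEq n] {A : Matrix n n ℤ}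
    (hA : A.IsSymm) :
    sigmaCount A = (A.map (fun x : ℤ => (x : ℝ))).charpoly.roots.countP (· ≤ 0) := by
  have h := isHermitian_map_intCast hA
  rw [sigmaCount, dif_pos h, h.roots_charpoly_eq_eigenvalues, Multiset.countP_map]
  rfl

theorem sigmaCount_fromBlocks {m n : Type*} [Fintype m] [DecidableEq m] [Fintype n]
    [DecidableEq n] {A : Matrix m m ℤ} {B : Matrix n n ℤ} (hA : A.IsSymm) (hB : B.IsSymm) :
    sigmaCount (Matrix.fromBlocks A 0 0 B) = sigmaCount A + sigmaCount B := by
  classical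
  have h : (Matrix.fromBlocks A 0 0 B).IsSymm := hA.fromBlocks (by simp) hB
  rw [sigmaCount_eq_countP_roots h, sigmaCount_eq_countP_roots hA, sigmaCount_eq_countP_roots hB,
    Matrix.fromBlocks_map, Matrix.map_zero _ Int.cast_zero, Matrix.map_zero _ Int.cast_zero,
    Matrix.charpoly_fromBlocks_zero₁₂, Polynomial.roots_mul, Multiset.countP_add]
  exact mul_ne_zero (Matrix.charpoly_monic _).ne_zero (Matrix.charpoly_monic _).ne_zero

theorem sigmaCount_neg_one : sigmaCount (-1 : Matrix (Fin 1) (Fin 1) ℤ) = 1 := by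
  classical
  rw [sigmaCount_eq_countP_roots (by simp [Matrix.IsSymm])]
  have h : ((-1 : Matrix (Fin 1) (Fin 1) ℤ).map (fun x : ℤ => (x : ℝ))).charpoly
      = Polynomial.X - Polynomial.C (-1) := by
    simp [Matrix.charpoly, Matrix.charmatrix]
  rw [h, Polynomial.roots_X_sub_C, Multiset.countP_eq_card_filter, Multiset.filter_singleton]
  simp

theorem sum_qRoot_fromBlocks_neg_one {m : Type*} [Fintype m] [DecidableEq m] (N : ℕ) [NeZero N]
    (A : Matrix m m ℤ) :
    ∑ x ∈ Fintype.piFinset (fun _ : m ⊕ Fin 1 => range N),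
        qRoot N ^ (∑ i, ∑ j, (x i : ℤ) *
          Matrix.fromBlocks A 0 0 (-1 : Matrix (Fin 1) (Fin 1) ℤ) i j * (x j : ℤ)) =
      (∑ x ∈ Fintype.piFinset (fun _ : m => range N),
        qRoot N ^ (∑ i, ∑ j, (x i : ℤ) * A i j * (x j : ℤ))) * gauss N (-1) := by
  rw [gauss, Finset.sum_mul_sum, ← Finset.sum_product']
  refine Finset.sum_nbij' (fun x => (fun i => x (Sum.inl i), x (Sum.inr 0)))
    (fun p => Sum.elim p.1 fun _ => p.2) ?_ ?_ ?_ ?_ ?_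
  · intro x hx
    simp only [Fintype.mem_piFinset] at hx
    simp only [mem_product, Fintype.mem_piFinset]
    exact ⟨fun i => hx _, hx _⟩
  · intro p hp
    simp only [mem_product, Fintype.mem_piFinset] at hp
    simp only [Fintype.mem_piFinset]
    rintro (i | i)
    · exact hp.1 i
    · exact hp.2
  · intro x _
    ext (i | i)
    · rfl
    · simp [Subsingleton.elim i 0]
  · intro p _
    rfl
  · intro x _
    have hq : qRoot N ≠ 0 := Complex.exp_ne_zero _
    rw [← zpow_add₀ hq]
    congr 1
    simp [Fintype.sum_sum_type]
    ring

/-- `F_N` is unchanged under the special Kirby `(-)`-move on the linking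
matrix: `F_N(A ⊕ (-1)) = F_N(A)` for every symmetric integer matrix `A`. -/
theorem FN_kirby_minus (r : ℕ) (hr : 1 ≤ r) {m : ℕ}
    (A : Matrix (Fin m) (Fin m) ℤ) (hA : A.IsSymm) :
    FN r (Matrix.fromBlocks A 0 0 (-1 : Matrix (Fin 1) (Fin 1) ℤ)) = FN r A := by
  have hN : Odd (2 * r + 1) := odd_two_mul_add_one r
  have hG := gauss_neg_one_ne_zero hN
  have hs : (Real.sqrt (2 * r + 1) : ℂ) ≠ 0 := by
    have : 0 < Real.sqrt (2 * r + 1) := Real.sqrt_pos.mpr (by positivity)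
    exact_mod_cast this.ne'
  have hg : gauss (2 * r + 1) ((2 * r + 1 : ℤ) - 1) = gauss (2 * r + 1) (-1) := by
    rw [← gauss_sub_one]
    push_cast
    rfl
  rw [FN, FN, sum_qRoot_fromBlocks_neg_one, sigmaCount_fromBlocks hA (by simp [Matrix.IsSymm]),
    sigmaCount_neg_one, hg, Fintype.card_sum, Fintype.card_fin, Fintype.card_fin]
  set s : ℂ := (Real.sqrt (2 * r + 1) : ℂ)
  set g := gauss (2 * r + 1) (-1)
  have h1 : (-((m + 1 : ℕ) : ℤ)) = -(m : ℤ) - 1 := by push_cast; ring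
  have h2 : ((m + 1 : ℕ) : ℤ) - 2 * ((sigmaCount A + 1 : ℕ) : ℤ)
      = ((m : ℤ) - 2 * (sigmaCount A : ℤ)) - 1 := by push_cast; ring
  rw [h1, h2, zpow_sub_one₀ hs, zpow_sub_one₀ (div_ne_zero hG hs)]
  field_simp

end
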